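/- Let r ≥ 2 and s ≥ 3, and let S be a general position set of the cylinder P_r □ C_s. If some C_s-layer contains exactly two vertices of S, then |S| ≤ 4. -/

import Mathlib

open SimpleGraph

/-- The interval `I[u,v]`: vertices lying on some `u,v`-geodesic. -/
def gpInterval {V : Type*} (G : SimpleGraph V) (u v : V) : Set V :=
  {x | G.dist u x + G.dist x v = G.dist u v}

/-- `S` is a general position set: no three distinct vertices of `S` lie on a common geodesic. -/
def IsGPSet {V : Type*} (G : SimpleGraph V) (S : Set V) : Prop :=
  ∀ u ∈ S, ∀ v ∈ S, ∀ w ∈ S, u ≠ v → u ≠ w → v ≠ w → w ∉ gpInterval G u v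

/-- cyclic distance -/
def cycD (s a b : ℕ) : ℕ := min (max a b - min a b) (s - (max a b - min a b))

lemma cycD_comm (s a b : ℕ) : cycD s a b = cycD s b a := by
  unfold cycD; rw [max_comm, min_comm a b]

lemma cycD_le (s a b : ℕ) (h : a ≤ b) (hb : b < s) :
    (a + cycD s a b = b ∧ 2 * b ≤ s + 2 * a) ∨ (b + cycD s a b = s + a ∧ s + 2 * a < 2 * b) := by
  unfold cycD; omega

lemma cycD_ge (s a b : ℕ) (h : b ≤ a) (hb : a < s) :
    (b + cycD s a b = a ∧ 2 * a ≤ s + 2 * b) ∨ (a + cycD s a b = s + b ∧ s + 2 * b < 2 * a) := by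
  unfold cycD; omega

lemma cycD_same (s a b y z : ℕ) (ha : a < b) (hb : b < s) (hy : y < s) (hz : z < s)
    (h3 : cycD s b a + cycD s a z ≠ cycD s b z) (h4 : cycD s a b + cycD s b z ≠ cycD s a z)
    (h : (a < y ∧ y < b) ↔ (a < z ∧ z < b)) :
    cycD s a y + cycD s y z = cycD s a z ∨ cycD s b y + cycD s y z = cycD s b z := by
  rw [cycD_comm s b a] at h3
  have k1 := cycD_le s a b ha.le hb
  have ha' : a < s := ha.trans hb
  rcases le_total a y with h5 | h5 <;> rcases le_total b y with h6 | h6 <;>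
  rcases le_total a z with h7 | h7 <;> rcases le_total b z with h8 | h8 <;>
  rcases le_total y z with h9 | h9 <;> try omega
  all_goals
    have k2 := by first | exact cycD_le s a y h5 hy | exact cycD_ge s a y h5 ha'
    have k3 := by first | exact cycD_le s b y h6 hy | exact cycD_ge s b y h6 hb
    have k4 := by first | exact cycD_le s a z h7 hz | exact cycD_ge s a z h7 ha'
    have k5 := by first | exact cycD_le s b z h8 hz | exact cycD_ge s b z h8 hb
    have k6 := by first | exact cycD_le s y z h9 hz | exact cycD_ge s y z h9 hy
    generalize cycD s a y = d2 at *
    generalize cycD s b y = d3 at *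
    generalize cycD s a z = d4 at *
    generalize cycD s b z = d5 at *
    generalize cycD s y z = d6 at *
    generalize cycD s a b = d1 at *
    rcases k1 with k1 | k1 <;> rcases k4 with k4 | k4 <;> rcases k5 with k5 | k5 <;>
      try omega

lemma cycD_diff (s a b y z : ℕ) (ha : a < b) (hb : b < s) (hy : y < s) (hz : z < s)
    (hya : y ≠ a) (hyb : y ≠ b) (hza : z ≠ a) (hzb : z ≠ b)
    (h : ¬ ((a < y ∧ y < b) ↔ (a < z ∧ z < b))) :
    cycD s y a + cycD s a z = cycD s y z ∨ cycD s y b + cycD s b z = cycD s y z := by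
  rw [cycD_comm s y a, cycD_comm s y b]
  have ha' : a < s := ha.trans hb
  rcases le_total a y with h5 | h5 <;> rcases le_total b y with h6 | h6 <;>
  rcases le_total a z with h7 | h7 <;> rcases le_total b z with h8 | h8 <;>
  rcases le_total y z with h9 | h9 <;> try omega
  all_goals
    have k2 := by first | exact cycD_le s a y h5 hy | exact cycD_ge s a y h5 ha'
    have k3 := by first | exact cycD_le s b y h6 hy | exact cycD_ge s b y h6 hb
    have k4 := by first | exact cycD_le s a z h7 hz | exact cycD_ge s a z h7 ha'
    have k5 := by first | exact cycD_le s b z h8 hz | exact cycD_ge s b z h8 hb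
    have k6 := by first | exact cycD_le s y z h9 hz | exact cycD_ge s y z h9 hy
    generalize cycD s a y = d2 at *
    generalize cycD s b y = d3 at *
    generalize cycD s a z = d4 at *
    generalize cycD s b z = d5 at *
    generalize cycD s y z = d6 at *
    rcases k2 with k2 | k2 <;> rcases k6 with k6 | k6 <;> rcases k5 with k5 | k5 <;>
      try omega

/-- path distance -/
def pthD (a b : ℕ) : ℕ := max a b - min a b

lemma path_dist_le (r : ℕ) (u : Fin r) : ∀ (k : ℕ) (v : Fin r), v.val = u.val + k →
    (pathGraph r).dist u v ≤ k := by
  intro k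
  induction k with
  | zero => intro v hv; have : v = u := Fin.ext (by omega)
            subst this; simp
  | succ k ih =>
    intro v hv
    have hw : u.val + k < r := by have := v.2; omega
    have h1 := ih ⟨u.val + k, hw⟩ rfl
    have hadj : (pathGraph r).Adj ⟨u.val + k, hw⟩ v := by
      rw [pathGraph_adj]; left; simp; omega
    have h2 := hadj.reachable.dist_triangle_right u
    have h3 := dist_eq_one_iff_adj.2 hadj
    omega

lemma path_dist (r : ℕ) (u v : Fin r) : (pathGraph r).dist u v = pthD u v := by
  apply le_antisymm
  · unfold pthD
    rcases le_total u.val v.val with h | h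
    · exact (path_dist_le r u (v.val - u.val) v (by omega)).trans (by omega)
    · rw [dist_comm]
      exact (path_dist_le r v (u.val - v.val) u (by omega)).trans (by omega)
  · obtain ⟨w, hw⟩ := (pathGraph_preconnected r u v).exists_walk_length_eq_dist
    rw [← hw]; clear hw
    induction w with
    | nil => simp [pthD]
    | cons h p ih =>
      rw [pathGraph_adj] at h
      rw [Walk.length_cons]
      unfold pthD at *
      omega

lemma cyc_adj (s : ℕ) (hs : 3 ≤ s) (u v : Fin s) : (cycleGraph s).Adj u v ↔
    (u.val + 1 = v.val ∨ v.val + 1 = u.val ∨ (u.val = 0 ∧ v.val + 1 = s) ∨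
      (v.val = 0 ∧ u.val + 1 = s)) := by
  rw [cycleGraph_adj']
  have hu := u.2
  have hv := v.2
  rcases lt_trichotomy u v with h | h | h
  · rw [Fin.coe_sub_iff_lt.2 h, Fin.coe_sub_iff_le.2 h.le]
    have : u.val < v.val := h
    omega
  · subst h
    have h0 : (u - u).val = 0 := by rw [Fin.coe_sub_iff_le.2 le_rfl]; omega
    omega
  · rw [Fin.coe_sub_iff_lt.2 h, Fin.coe_sub_iff_le.2 h.le]
    have : v.val < u.val := h
    omega

lemma cyc_dist_le (s : ℕ) (hs : 3 ≤ s) (u v : Fin s) (h : u.val ≤ v.val) :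
    (cycleGraph s).dist u v ≤ cycD s u v := by
  have hp : ∀ x y : Fin s, (cycleGraph s).dist x y ≤ pthD x y := fun x y => by
    rw [← path_dist]
    exact (pathGraph_preconnected s x y).dist_anti pathGraph_le_cycleGraph
  have h1 := hp u v
  let o : Fin s := ⟨0, by omega⟩
  let e : Fin s := ⟨s - 1, by omega⟩
  have h2 := hp u o
  have h3 := hp e v
  have hadj : (cycleGraph s).Adj o e := by
    rw [cyc_adj s hs]; right; right; left; simp [o, e]; omega
  have h4 := dist_eq_one_iff_adj.2 hadj
  have h5 := (cycleGraph_preconnected (n := s) u o).dist_triangle_left e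
  have h6 := (cycleGraph_preconnected (n := s) u e).dist_triangle_left v
  have ho : o.val = 0 := rfl
  have he : e.val = s - 1 := rfl
  have hv := v.2
  unfold cycD
  unfold pthD at *
  omega

lemma cyc_dist (s : ℕ) (hs : 3 ≤ s) (u v : Fin s) : (cycleGraph s).dist u v = cycD s u v := by
  apply le_antisymm
  · rcases le_total u.val v.val with h | h
    · exact cyc_dist_le s hs u v h
    · rw [dist_comm, cycD_comm]; exact cyc_dist_le s hs v u h
  · obtain ⟨w, hw⟩ := (cycleGraph_preconnected (n := s) u v).exists_walk_length_eq_dist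
    rw [← hw]; clear hw
    induction w with
    | nil => simp [cycD]
    | @cons x y z h p ih =>
      rw [cyc_adj s hs] at h
      rw [Walk.length_cons]
      have := x.2
      have := y.2
      have := z.2
      unfold cycD at *
      omega

lemma cyl_dist (r s : ℕ) (hs : 3 ≤ s) (p q : Fin r × Fin s) :
    (pathGraph r □ cycleGraph s).dist p q = pthD p.1 q.1 + cycD s p.2 q.2 := by
  rw [← path_dist, ← cyc_dist s hs]
  have h1 := pathGraph_preconnected r p.1 q.1
  have h2 := cycleGraph_preconnected (n := s) p.2 q.2
  have h3 : (pathGraph r □ cycleGraph s).Reachable p q := reachable_boxProd.2 ⟨h1, h2⟩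
  have h := edist_boxProd (G := pathGraph r) (H := cycleGraph s) p q
  rw [← h1.coe_dist_eq_edist, ← h2.coe_dist_eq_edist, ← h3.coe_dist_eq_edist] at h
  exact_mod_cast h

lemma pair_key (r s : ℕ) (S : Set (Fin r × Fin s))
    (H : ∀ u ∈ S, ∀ v ∈ S, ∀ w ∈ S, u ≠ v → u ≠ w → v ≠ w →
      pthD u.1 w.1 + pthD w.1 v.1 = pthD u.1 v.1 →
      cycD s u.2 w.2 + cycD s w.2 v.2 ≠ cycD s u.2 v.2)
    (i : Fin r) (a b : Fin s) (hab : a.val < b.val) (ha : (i, a) ∈ S) (hb : (i, b) ∈ S)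
    (z w : Fin r × Fin s) (hz : z ∈ S) (hw : w ∈ S) (hzw : z ≠ w)
    (hzi : z.1 ≠ i) (hwi : w.1 ≠ i) :
    ((a.val < z.2.val ∧ z.2.val < b.val) ↔ (a.val < w.2.val ∧ w.2.val < b.val)) ↔
      ¬ (z.1.val < i.val ↔ w.1.val < i.val) := by
  have hne : ∀ (x : Fin r × Fin s) (c : Fin s), x.1 ≠ i → x ≠ (i, c) := by
    rintro x c hx rfl; exact hx rfl
  have hpq : ((i, a) : Fin r × Fin s) ≠ (i, b) := by
    intro h; simp only [Prod.mk.injEq, true_and] at h; rw [h] at hab; exact lt_irrefl _ hab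
  have hval : ∀ x : Fin r × Fin s, x.1 ≠ i → x.1.val ≠ i.val := fun x hx h => hx (Fin.ext h)
  have A : ∀ x ∈ S, x.1 ≠ i → cycD s b a + cycD s a x.2 ≠ cycD s b x.2 ∧
      cycD s a b + cycD s b x.2 ≠ cycD s a x.2 := by
    intro x hx hxi
    refine ⟨H _ hb x hx _ ha (hne x _ hxi).symm hpq.symm (hne x _ hxi) ?_,
      H _ ha x hx _ hb (hne x _ hxi).symm hpq (hne x _ hxi) ?_⟩ <;>
    simp [pthD]
  have hz' := hval z hzi
  have hw' := hval w hwi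
  have same : ∀ x ∈ S, ∀ y ∈ S, x ≠ y → x.1 ≠ i → y.1 ≠ i →
      ((a.val < x.2.val ∧ x.2.val < b.val) ↔ (a.val < y.2.val ∧ y.2.val < b.val)) →
      pthD i x.1 + pthD x.1 y.1 = pthD i y.1 → False := by
    intro x hx y hy hxy hxi hyi h hp
    rcases cycD_same s a b x.2 y.2 hab b.2 x.2.2 y.2.2 (A y hy hyi).1 (A y hy hyi).2 h with h' | h'
    · exact H _ ha y hy x hx (hne y _ hyi).symm (hne x _ hxi).symm hxy.symm hp h'
    · exact H _ hb y hy x hx (hne y _ hyi).symm (hne x _ hxi).symm hxy.symm hp h'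
  constructor
  · intro h hside
    rcases le_total (pthD i z.1) (pthD i w.1) with hle | hle
    · exact same z hz w hw hzw hzi hwi h (by unfold pthD at *; omega)
    · exact same w hw z hz hzw.symm hwi hzi h.symm (by unfold pthD at *; omega)
  · intro hside
    by_contra h
    have hp : pthD z.1 i + pthD i w.1 = pthD z.1 w.1 := by unfold pthD at *; omega
    have N : ∀ x ∈ S, x.1 ≠ i → x.2.val ≠ a.val ∧ x.2.val ≠ b.val := by
      intro x hx hxi
      have := A x hx hxi
      constructor <;> intro hh <;> rw [hh] at this <;> simp [cycD] at this
    rcases cycD_diff s a b z.2 w.2 hab b.2 z.2.2 w.2.2 (N z hz hzi).1 (N z hz hzi).2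
      (N w hw hwi).1 (N w hw hwi).2 h with h' | h'
    · exact H z hz w hw _ ha hzw (hne z _ hzi) (hne w _ hwi) hp h'
    · exact H z hz w hw _ hb hzw (hne z _ hzi) (hne w _ hwi) hp h'

lemma prop_aux (P1 P2 P3 Q1 Q2 Q3 : Prop) (k1 : (P1 ↔ P2) ↔ ¬ (Q1 ↔ Q2))
    (k2 : (P1 ↔ P3) ↔ ¬ (Q1 ↔ Q3)) (k3 : (P2 ↔ P3) ↔ ¬ (Q2 ↔ Q3)) : False := by
  grind

theorem stmt_13 (r s : ℕ) (hr : 2 ≤ r) (hs : 3 ≤ s)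
    (S : Set (Fin r × Fin s)) (hS : IsGPSet (pathGraph r □ cycleGraph s) S)
    (hlayer : ∃ i : Fin r, (({i} ×ˢ (Set.univ : Set (Fin s))) ∩ S).ncard = 2) :
    S.ncard ≤ 4 := by
  obtain ⟨i, hi⟩ := hlayer
  have H : ∀ u ∈ S, ∀ v ∈ S, ∀ w ∈ S, u ≠ v → u ≠ w → v ≠ w →
      pthD u.1 w.1 + pthD w.1 v.1 = pthD u.1 v.1 →
      cycD s u.2 w.2 + cycD s w.2 v.2 ≠ cycD s u.2 v.2 := by
    intro u hu v hv w hw h1 h2 h3 h4 h5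
    apply hS u hu v hv w hw h1 h2 h3
    simp only [gpInterval, Set.mem_setOf_eq, cyl_dist r s hs]
    omega
  by_contra hcard
  push Not at hcard
  have hT : ∀ x ∈ S, x.1 = i → x ∈ ({i} ×ˢ (Set.univ : Set (Fin s))) ∩ S := by
    intro x hx hxi
    exact ⟨by simp [hxi], hx⟩
  have hdiff := Set.ncard_sdiff_add_ncard_of_subset
    (Set.inter_subset_right : ({i} ×ˢ (Set.univ : Set (Fin s))) ∩ S ⊆ S) S.toFinite
  have h3 : 2 < (S \ (({i} ×ˢ (Set.univ : Set (Fin s))) ∩ S)).ncard := by omega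
  obtain ⟨x, y, z, hx, hy, hz, hxy, hxz, hyz⟩ := (Set.two_lt_ncard_iff (Set.toFinite _)).1 h3
  have hx1 : x.1 ≠ i := fun h => hx.2 (hT x hx.1 h)
  have hy1 : y.1 ≠ i := fun h => hy.2 (hT y hy.1 h)
  have hz1 : z.1 ≠ i := fun h => hz.2 (hT z hz.1 h)
  obtain ⟨p, q, hpq, hpqe⟩ := Set.ncard_eq_two.1 hi
  have hp : p ∈ ({i} ×ˢ (Set.univ : Set (Fin s))) ∩ S := by rw [hpqe]; simp
  have hq : q ∈ ({i} ×ˢ (Set.univ : Set (Fin s))) ∩ S := by rw [hpqe]; simp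
  have key : ∃ a b : Fin s, a.val < b.val ∧ (i, a) ∈ S ∧ (i, b) ∈ S := by
    obtain ⟨p1, p2⟩ := p
    obtain ⟨q1, q2⟩ := q
    have e1 : p1 = i := by simpa using hp.1
    have e2 : q1 = i := by simpa using hq.1
    subst e1
    subst e2
    have : p2.val ≠ q2.val := fun h => hpq (by rw [Fin.ext h])
    rcases lt_or_gt_of_ne this with h | h
    · exact ⟨p2, q2, h, hp.2, hq.2⟩
    · exact ⟨q2, p2, h, hq.2, hp.2⟩
  obtain ⟨a, b, hab, ha, hb⟩ := key
  have k1 := pair_key r s S H i a b hab ha hb x y hx.1 hy.1 hxy hx1 hy1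
  have k2 := pair_key r s S H i a b hab ha hb x z hx.1 hz.1 hxz hx1 hz1
  have k3 := pair_key r s S H i a b hab ha hb y z hy.1 hz.1 hyz hy1 hz1
  exact prop_aux _ _ _ _ _ _ k1 k2 k3
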